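/- arXiv:2111.02966 — 2 statements merged into one kernel-verified Lean document; each statement's English description precedes it below -/
import Mathlib

section
/- Let h > 0. For all η, δ ∈ ℝ and all τ with 0 ≤ τ ≤ h, the Huber penalty satisfies f_h(η + δ) − f_h(η) − f_h'(η)·δ ≥ (δ²/2)·1[|η| ≤ h − τ]·1[|δ| ≤ τ], where 1[·] denotes the indicator function. -/
/-- The Huber penalty with parameter `h`. -/
noncomputable def huber (h t : ℝ) : ℝ := if |t| ≤ h then t ^ 2 / 2 else h * (|t| - h / 2)

/-- The derivative of the Huber penalty with parameter `h`. -/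
noncomputable def huberDeriv (h t : ℝ) : ℝ := if |t| ≤ h then t else h * Real.sign t

/-- The Huber penalty dominates each of its supporting lines `t ↦ u * t - u ^ 2 / 2`, `|u| ≤ h`. -/
lemma mul_sub_sq_div_two_le_huber {h u : ℝ} (hu : |u| ≤ h) (t : ℝ) :
    u * t - u ^ 2 / 2 ≤ huber h t := by
  unfold huber
  split_ifs with ht
  · nlinarith [sq_nonneg (u - t)]
  · have hut : u * t ≤ |u| * |t| := (le_abs_self _).trans_eq (abs_mul u t)
    nlinarith [sq_abs u, mul_nonneg (sub_nonneg.2 hu) (sub_nonneg.2 (not_le.1 ht).le),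
      sq_nonneg (h - |u|)]

lemma abs_huberDeriv_le {h : ℝ} (hh : 0 ≤ h) (t : ℝ) : |huberDeriv h t| ≤ h := by
  unfold huberDeriv
  split_ifs with ht
  · exact ht
  · rcases Real.sign_apply_eq t with hs | hs | hs <;> simp [hs, abs_of_nonneg hh, hh]

/-- The supporting line of slope `huberDeriv h t` touches the Huber penalty at `t`. -/
lemma huber_eq_huberDeriv_mul_sub {h : ℝ} (hh : 0 ≤ h) (t : ℝ) :
    huber h t = huberDeriv h t * t - huberDeriv h t ^ 2 / 2 := by
  unfold huber huberDeriv
  split_ifs with ht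
  · ring
  · rcases lt_trichotomy t 0 with h0 | rfl | h0
    · rw [Real.sign_of_neg h0, abs_of_neg h0]; ring
    · simp [hh] at ht
    · rw [Real.sign_of_pos h0, abs_of_pos h0]; ring

/-- The first-order convexity inequality for the Huber penalty. -/
lemma huber_first_order {h : ℝ} (hh : 0 ≤ h) (η δ : ℝ) :
    0 ≤ huber h (η + δ) - huber h η - huberDeriv h η * δ := by
  have hle := mul_sub_sq_div_two_le_huber (abs_huberDeriv_le hh η) (η + δ)
  rw [huber_eq_huberDeriv_mul_sub hh η]
  linarith

/-- Second order behavior of the Huber-loss function: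
for all `η, δ ∈ ℝ` and `0 ≤ τ ≤ h`,
`f_h(η+δ) - f_h(η) - f_h'(η)·δ ≥ (δ²/2)·1[|η| ≤ h-τ]·1[|δ| ≤ τ]`. -/
theorem huber_second_order (h : ℝ) (hh : 0 < h) (η δ τ : ℝ) (hτ0 : 0 ≤ τ) (hτh : τ ≤ h) :
    huber h (η + δ) - huber h η - huberDeriv h η * δ ≥
      δ ^ 2 / 2 * (if |η| ≤ h - τ then (1 : ℝ) else 0) * (if |δ| ≤ τ then (1 : ℝ) else 0) := by
  have hconv := huber_first_order hh.le η δ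
  split_ifs with hη hδ
  · have hsum : |η + δ| ≤ h := (abs_add_le η δ).trans (by linarith)
    have hη' : |η| ≤ h := by linarith
    simp only [huber, huberDeriv, if_pos hsum, if_pos hη']
    linarith
  all_goals simpa using hconv
end

section
/- Let d ≥ 2, let 0 < ε < 1 and s > 0, and let X ∈ ℝ^{n×d} be a matrix whose every column X^i satisfies ‖X^i‖ ≤ √(νn). Define U_s = {β ∈ ℝ^d : ‖β‖₁ ≤ s·(1/√n)‖Xβ‖ and (1/√n)‖Xβ‖ ≤ 1} and the pseudometric ρ(β, β') = (1/√n)‖X(β − β')‖. Then U_s admits an ε-net with respect to ρ of cardinality at most exp(16·s²·ν·log d/ε²); that is, a subset N ⊆ U_s with |N| ≤ exp(16·s²·ν·log d/ε²) such that for every β ∈ U_s there is β' ∈ N with ρ(β, β') ≤ ε. -/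
/-- The Euclidean (ℓ²) norm of a finitely supported real vector. -/
noncomputable def l2norm {ι : Type*} [Fintype ι] (x : ι → ℝ) : ℝ :=
  Real.sqrt (∑ i, x i ^ 2)

/-- The ℓ¹ norm of a finitely supported real vector. -/
noncomputable def l1norm {ι : Type*} [Fintype ι] (x : ι → ℝ) : ℝ :=
  ∑ i, |x i|

/-- One greedy step of Maurey's argument: some atom `y i` does at least as well as the average. -/
lemma exists_norm_sub_sq_le {E ι : Type*} [NormedAddCommGroup E] [InnerProductSpace ℝ E]
    [Fintype ι] (y : ι → E) {R : ℝ} (hy : ∀ i, ‖y i‖ ≤ R) (p : ι → ℝ) (hp : ∀ i, 0 ≤ p i)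
    (hp1 : ∑ i, p i = 1) (z : E) :
    ∃ i, ‖z - y i‖ ^ 2 ≤ ‖z - ∑ i, p i • y i‖ ^ 2 + R ^ 2 := by
  by_contra! h
  set x := ∑ i, p i • y i with hx
  have hexp : ∑ i, p i * ‖z - y i‖ ^ 2 =
      ‖z‖ ^ 2 - 2 * inner ℝ z x + ∑ i, p i * ‖y i‖ ^ 2 := by
    have hinner : inner ℝ z x = ∑ i, p i * inner ℝ z (y i) := by
      rw [hx, inner_sum]
      simp only [inner_smul_right]
    simp only [norm_sub_sq_real, mul_add, mul_sub, Finset.sum_add_distrib,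
      Finset.sum_sub_distrib]
    rw [hinner, ← Finset.sum_mul, hp1, one_mul, Finset.mul_sum]
    simp only [mul_left_comm]
  have hR : ∑ i, p i * ‖y i‖ ^ 2 ≤ R ^ 2 := by
    calc ∑ i, p i * ‖y i‖ ^ 2 ≤ ∑ i, p i * R ^ 2 := by
          gcongr with i
          · exact hp i
          · exact hy i
      _ = R ^ 2 := by rw [← Finset.sum_mul, hp1, one_mul]
  have hlt : ‖z - x‖ ^ 2 + R ^ 2 < ∑ i, p i * ‖z - y i‖ ^ 2 := by
    calc ‖z - x‖ ^ 2 + R ^ 2 = ∑ i, p i * (‖z - x‖ ^ 2 + R ^ 2) := by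
          rw [← Finset.sum_mul, hp1, one_mul]
      _ < ∑ i, p i * ‖z - y i‖ ^ 2 := by
          apply Finset.sum_lt_sum
          · exact fun i _ => mul_le_mul_of_nonneg_left (h i).le (hp i)
          · obtain ⟨i, -, hi⟩ : ∃ i ∈ Finset.univ, p i ≠ 0 :=
              Finset.exists_ne_zero_of_sum_ne_zero (by rw [hp1]; exact one_ne_zero)
            exact ⟨i, Finset.mem_univ i,
              mul_lt_mul_of_pos_left (h i) (lt_of_le_of_ne (hp i) hi.symm)⟩
  rw [hexp, norm_sub_sq_real] at hlt
  nlinarith [sq_nonneg ‖x‖]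

/-- Maurey's empirical method: a convex combination of atoms is approximated by an average of
`k` of them. -/
lemma maurey_approximation {E ι : Type*} [NormedAddCommGroup E] [InnerProductSpace ℝ E]
    [Fintype ι] (y : ι → E) {R : ℝ} (hy : ∀ i, ‖y i‖ ≤ R) (p : ι → ℝ) (hp : ∀ i, 0 ≤ p i)
    (hp1 : ∑ i, p i = 1) (k : ℕ) :
    ∃ f : Fin k → ι, ‖(k : ℝ) • (∑ i, p i • y i) - ∑ l, y (f l)‖ ^ 2 ≤ k * R ^ 2 := by
  induction k with
  | zero => exact ⟨Fin.elim0, by simp⟩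
  | succ k ih =>
    obtain ⟨f, hf⟩ := ih
    set x := ∑ i, p i • y i
    obtain ⟨i, hi⟩ := exists_norm_sub_sq_le y hy p hp hp1
      (((k : ℝ) • x - ∑ l, y (f l)) + x)
    refine ⟨Fin.cons i f, ?_⟩
    rw [add_sub_cancel_right] at hi
    have heq : ((k + 1 : ℕ) : ℝ) • x - ∑ l, y (Fin.cons (α := fun _ => ι) i f l) =
        ((k : ℝ) • x - ∑ l, y (f l)) + x - y i := by
      rw [Fin.sum_univ_succ]
      simp only [Fin.cons_zero, Fin.cons_succ]
      push_cast
      rw [add_smul, one_smul]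
      abel
    rw [heq]
    push_cast
    linarith

/-- The vertices of the image under `L` of the `ℓ¹` ball of radius `s`. -/
noncomputable def crossVertex {E ι : Type*} [AddCommGroup E] [Module ℝ E] [DecidableEq ι]
    (L : (ι → ℝ) →ₗ[ℝ] E) (s : ℝ) (q : ι × Bool) : E :=
  (if q.2 then s else -s) • L (Pi.single q.1 1)

lemma map_eq_sum_smul_single {E ι : Type*} [AddCommGroup E] [Module ℝ E] [Fintype ι]
    [DecidableEq ι] (L : (ι → ℝ) →ₗ[ℝ] E) (β : ι → ℝ) :
    L β = ∑ j, β j • L (Pi.single j 1) := by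
  conv_lhs => rw [pi_eq_sum_univ' β]
  simp only [map_sum, map_smul]

lemma norm_map_le_mul_l1norm {E ι : Type*} [NormedAddCommGroup E] [NormedSpace ℝ E] [Fintype ι]
    [DecidableEq ι] (L : (ι → ℝ) →ₗ[ℝ] E) {R : ℝ} (hL : ∀ j, ‖L (Pi.single j 1)‖ ≤ R)
    (β : ι → ℝ) : ‖L β‖ ≤ R * l1norm β := by
  rw [map_eq_sum_smul_single, l1norm, Finset.mul_sum]
  refine norm_sum_le_of_le _ fun j _ => ?_
  rw [norm_smul, Real.norm_eq_abs, mul_comm]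
  exact mul_le_mul_of_nonneg_right (hL j) (abs_nonneg _)

/-- Points of the `ℓ¹` ball are convex combinations of the signed, scaled basis vectors. -/
lemma exists_weights_crossVertex {E ι : Type*} [AddCommGroup E] [Module ℝ E] [Fintype ι]
    [DecidableEq ι] [Nonempty ι] (L : (ι → ℝ) →ₗ[ℝ] E) {s : ℝ} (hs : 0 < s) (β : ι → ℝ)
    (hβ : l1norm β ≤ s) :
    ∃ p : ι × Bool → ℝ, (∀ q, 0 ≤ p q) ∧ ∑ q, p q = 1 ∧
      ∑ q, p q • crossVertex L s q = L β := by
  have hcard : (0 : ℝ) < Fintype.card ι := by exact_mod_cast Fintype.card_pos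
  refine ⟨fun q => (|β q.1| + (if q.2 then β q.1 else -β q.1)) / (2 * s) +
    (1 - l1norm β / s) / (2 * Fintype.card ι), fun q => ?_, ?_, ?_⟩
  · have h1 : 0 ≤ 1 - l1norm β / s := by
      rw [sub_nonneg, div_le_one hs]
      exact hβ
    have h2 : 0 ≤ |β q.1| + (if q.2 then β q.1 else -β q.1) := by
      split_ifs
      · linarith [neg_abs_le (β q.1)]
      · linarith [le_abs_self (β q.1)]
    positivity
  · rw [Fintype.sum_prod_type]
    have h : ∀ j : ι, ∑ b : Bool, ((|β j| + (if b then β j else -β j)) / (2 * s) +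
        (1 - l1norm β / s) / (2 * Fintype.card ι)) =
        |β j| / s + (1 - l1norm β / s) / Fintype.card ι := by
      intro j
      simp only [Fintype.sum_bool, if_true, Bool.false_eq_true, if_false]
      field_simp
      ring
    rw [Finset.sum_congr rfl fun j _ => h j, Finset.sum_add_distrib, ← Finset.sum_div]
    change l1norm β / s + _ = 1
    rw [Finset.sum_const, Finset.card_univ, nsmul_eq_mul]
    field_simp
    ring
  · rw [Fintype.sum_prod_type, map_eq_sum_smul_single L β]
    refine Finset.sum_congr rfl fun j _ => ?_
    simp only [crossVertex, Fintype.sum_bool, if_true, Bool.false_eq_true, if_false, smul_smul]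
    rw [← add_smul]
    congr 1
    field_simp
    ring

/-- A finite family of centres covering a set at scale `ε / 2` yields an `ε`-net inside the set. -/
lemma exists_internal_net {α E T : Type*} [PseudoMetricSpace E] [Fintype T] (g : α → E)
    (U : Set α) (c : T → E) {ε : ℝ} (hc : ∀ a ∈ U, ∃ t, dist (g a) (c t) ≤ ε / 2) :
    ∃ N : Finset α, (∀ a ∈ N, a ∈ U) ∧ N.card ≤ Fintype.card T ∧
      ∀ a ∈ U, ∃ b ∈ N, dist (g a) (g b) ≤ ε := by
  classical
  let S : Finset T := {t | ∃ a ∈ U, dist (g a) (c t) ≤ ε / 2}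
  have hS : ∀ t : S, ∃ a ∈ U, dist (g a) (c t) ≤ ε / 2 := fun t => by
    simpa only [S, Finset.mem_filter_univ] using t.2
  choose r hrU hr using hS
  refine ⟨Finset.univ.image r, ?_, ?_, fun a ha => ?_⟩
  · simp only [Finset.mem_image, Finset.mem_univ, true_and]
    rintro _ ⟨t, rfl⟩
    exact hrU t
  · exact Finset.card_image_le.trans (by simpa using Finset.card_le_univ S)
  · obtain ⟨t, ht⟩ := hc a ha
    have htS : t ∈ S := by simpa [S] using ⟨a, ha, ht⟩
    refine ⟨r ⟨t, htS⟩, by simp, ?_⟩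
    linarith [dist_triangle_right (g a) (g (r ⟨t, htS⟩)) (c t), hr ⟨t, htS⟩]

lemma two_mul_pow_ceil_le_exp {d : ℕ} (hd : 2 ≤ d) {A : ℝ} (hA : 1 ≤ A) :
    (((d * 2) ^ ⌈4 * A⌉₊ : ℕ) : ℝ) ≤ Real.exp (16 * A * Real.log d) := by
  have hd0 : (0 : ℝ) < d := by positivity
  have hlog : 0 ≤ Real.log d := Real.log_natCast_nonneg d
  have hk : (⌈4 * A⌉₊ : ℝ) < 4 * A + 1 := Nat.ceil_lt_add_one (by linarith)
  calc (((d * 2) ^ ⌈4 * A⌉₊ : ℕ) : ℝ) ≤ (((d * d) ^ ⌈4 * A⌉₊ : ℕ) : ℝ) := by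
        gcongr
    _ = Real.exp (⌈4 * A⌉₊ * (2 * Real.log d)) := by
        rw [Real.exp_nat_mul, two_mul, Real.exp_add, Real.exp_log hd0]
        push_cast
        rfl
    _ ≤ Real.exp (16 * A * Real.log d) := by
        apply Real.exp_le_exp.mpr
        nlinarith

/-- Nets for approximately sparse vectors, for a general linear map into an inner product space. -/
lemma exists_net_sparse {E : Type*} [NormedAddCommGroup E] [InnerProductSpace ℝ E] {d : ℕ}
    (hd : 2 ≤ d) {ε s ν : ℝ} (hε0 : 0 < ε) (hε1 : ε < 1) (hs : 0 < s) (hν : 0 < ν)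
    (L : (Fin d → ℝ) →ₗ[ℝ] E) (hL : ∀ j, ‖L (Pi.single j 1)‖ ≤ √ν) :
    ∃ N : Finset (Fin d → ℝ), (∀ β ∈ N, l1norm β ≤ s * ‖L β‖ ∧ ‖L β‖ ≤ 1) ∧
      (N.card : ℝ) ≤ Real.exp (16 * s ^ 2 * ν * Real.log d / ε ^ 2) ∧
      ∀ β : Fin d → ℝ, l1norm β ≤ s * ‖L β‖ → ‖L β‖ ≤ 1 → ∃ β' ∈ N, ‖L (β - β')‖ ≤ ε := by
  have hsqrt : √ν ^ 2 = ν := Real.sq_sqrt hν.le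
  rcases lt_or_ge (√ν * s) 1 with hsmall | hlarge
  · refine ⟨{0}, by simp [l1norm], ?_, fun β h1 _ => ⟨0, by simp, ?_⟩⟩
    · rw [Finset.card_singleton, Nat.cast_one]
      have hlog : 0 ≤ Real.log d := Real.log_natCast_nonneg d
      exact Real.one_le_exp (by positivity)
    · have h2 := norm_map_le_mul_l1norm L hL β
      have h3 : √ν * l1norm β ≤ √ν * (s * ‖L β‖) := by gcongr
      have h4 : ‖L β‖ ≤ 0 := by nlinarith [norm_nonneg (L β)]
      rw [sub_zero]
      linarith
  · set A : ℝ := s ^ 2 * ν / ε ^ 2 with hA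
    have hsν : 1 ≤ s ^ 2 * ν := by
      nlinarith
    have hA1 : 1 ≤ A := by
      rw [hA, one_le_div (by positivity)]
      nlinarith
    set k := ⌈4 * A⌉₊
    have hkA : 4 * A ≤ k := Nat.le_ceil _
    have hk0 : (0 : ℝ) < k := by linarith
    have : Nonempty (Fin d) := ⟨⟨0, by omega⟩⟩
    have hvertex : ∀ q, ‖crossVertex L s q‖ ≤ s * √ν := by
      intro q
      have habs : ‖(if q.2 then s else -s)‖ = s := by
        split_ifs <;> simp [abs_of_pos hs]
      rw [crossVertex, norm_smul, habs]
      exact mul_le_mul_of_nonneg_left (hL _) hs.le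
    obtain ⟨N, hNU, hNcard, hN⟩ := exists_internal_net (ε := ε) L
      {β | l1norm β ≤ s * ‖L β‖ ∧ ‖L β‖ ≤ 1}
      (fun f : Fin k → Fin d × Bool => (k : ℝ)⁻¹ • ∑ l, crossVertex L s (f l)) (by
        rintro β ⟨h1, h2⟩
        obtain ⟨p, hp, hp1, hpβ⟩ := exists_weights_crossVertex L hs β
          (h1.trans (mul_le_of_le_one_right hs.le h2))
        obtain ⟨f, hf⟩ := maurey_approximation (crossVertex L s) hvertex p hp hp1 k
        rw [hpβ] at hf
        refine ⟨f, ?_⟩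
        have hscale : (k : ℝ) • L β - ∑ l, crossVertex L s (f l) =
            (k : ℝ) • (L β - (k : ℝ)⁻¹ • ∑ l, crossVertex L s (f l)) := by
          rw [smul_sub, smul_inv_smul₀ hk0.ne']
        rw [hscale, norm_smul, Real.norm_of_nonneg hk0.le, ← dist_eq_norm, mul_pow, mul_pow,
          hsqrt, sq (k : ℝ), mul_assoc, mul_le_mul_iff_right₀ hk0] at hf
        have hAε : s ^ 2 * ν = A * ε ^ 2 := by
          rw [hA]
          field_simp
        refine le_of_sq_le_sq ?_ (by positivity)
        refine le_of_mul_le_mul_left (hf.trans ?_) hk0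
        rw [hAε]
        nlinarith [sq_nonneg ε])
    refine ⟨N, hNU, ?_, fun β h1 h2 => ?_⟩
    · have hcard : Fintype.card (Fin k → Fin d × Bool) = (d * 2) ^ k := by simp
      rw [hcard] at hNcard
      calc (N.card : ℝ) ≤ (((d * 2) ^ k : ℕ) : ℝ) := by exact_mod_cast hNcard
        _ ≤ Real.exp (16 * A * Real.log d) := two_mul_pow_ceil_le_exp hd hA1
        _ = Real.exp (16 * s ^ 2 * ν * Real.log d / ε ^ 2) := by
            congr 1
            rw [hA]
            ring
    · obtain ⟨β', hβ', hdist⟩ := hN β ⟨h1, h2⟩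
      refine ⟨β', hβ', ?_⟩
      rwa [map_sub, ← dist_eq_norm]

lemma l2norm_eq_norm_toLp {ι : Type*} [Fintype ι] (x : ι → ℝ) :
    l2norm x = ‖WithLp.toLp 2 x‖ := by
  simp [l2norm, EuclideanSpace.norm_eq]

/-- The map `β ↦ (1 / √n) X β` into Euclidean space. -/
noncomputable def scaledMulVec {n d : ℕ} (X : Matrix (Fin n) (Fin d) ℝ) :
    (Fin d → ℝ) →ₗ[ℝ] EuclideanSpace ℝ (Fin n) :=
  (1 / √(n : ℝ)) • ((WithLp.linearEquiv 2 ℝ (Fin n → ℝ)).symm.toLinearMap ∘ₗ X.mulVecLin)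

lemma norm_scaledMulVec {n d : ℕ} (X : Matrix (Fin n) (Fin d) ℝ) (β : Fin d → ℝ) :
    ‖scaledMulVec X β‖ = (1 / √(n : ℝ)) * l2norm (X.mulVec β) := by
  have h : scaledMulVec X β = (1 / √(n : ℝ)) • WithLp.toLp 2 (X.mulVec β) := rfl
  rw [h, norm_smul, l2norm_eq_norm_toLp, Real.norm_of_nonneg (by positivity)]

/-- ε-net for approximately sparse vectors: if every column of `X` satisfies `‖X^i‖ ≤ √(νn)`,
then `U_s = {β : ‖β‖₁ ≤ s·(1/√n)‖Xβ‖, (1/√n)‖Xβ‖ ≤ 1}` admits an ε-net of cardinality at most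
`exp(16 s² ν log d / ε²)` with respect to the pseudometric `ρ(β,β') = (1/√n)‖X(β−β')‖`. -/
theorem eps_net_sparse (n d : ℕ) (hd : 2 ≤ d) (ε s ν : ℝ)
    (hε0 : 0 < ε) (hε1 : ε < 1) (hs : 0 < s) (hν : 0 < ν)
    (X : Matrix (Fin n) (Fin d) ℝ)
    (hX : ∀ j, l2norm (fun i => X i j) ≤ Real.sqrt (ν * n)) :
    ∃ 𝒩 : Finset (Fin d → ℝ),
      (∀ β ∈ 𝒩, l1norm β ≤ s * ((1 / Real.sqrt n) * l2norm (X.mulVec β)) ∧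
        (1 / Real.sqrt n) * l2norm (X.mulVec β) ≤ 1) ∧
      (𝒩.card : ℝ) ≤ Real.exp (16 * s ^ 2 * ν * Real.log d / ε ^ 2) ∧
      ∀ β : Fin d → ℝ, l1norm β ≤ s * ((1 / Real.sqrt n) * l2norm (X.mulVec β)) →
        (1 / Real.sqrt n) * l2norm (X.mulVec β) ≤ 1 →
        ∃ β' ∈ 𝒩, (1 / Real.sqrt n) * l2norm (X.mulVec (β - β')) ≤ ε := by
  have hcol : ∀ j, ‖scaledMulVec X (Pi.single j 1)‖ ≤ √ν := by
    intro j
    rw [norm_scaledMulVec, Matrix.mulVec_single_one]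
    calc (1 / √(n : ℝ)) * l2norm (X.col j) ≤ (1 / √(n : ℝ)) * √(ν * n) := by
          gcongr
          exact hX j
      _ = √ν * (√(n : ℝ) / √(n : ℝ)) := by
          rw [Real.sqrt_mul hν.le]
          ring
      _ ≤ √ν := mul_le_of_le_one_right (Real.sqrt_nonneg _) (div_self_le_one _)
  simpa only [norm_scaledMulVec] using exists_net_sparse hd hε0 hε1 hs hν (scaledMulVec X) hcol
end
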